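/- arXiv:2509.02117 — 5 statements merged into one kernel-verified Lean document; each statement's English description precedes it below -/
import Mathlib

section
/- Substitution lemma for context-free languages: Let Σ be a finite alphabet and L ⊆ Σ* an infinite context-free language. For every μ ∈ ℕ with μ ≥ 1 there exist M ∈ ℕ with M ≥ 1 and infinite sets U₁, …, U_M ⊆ (Σ*)² such that: (1) for each i ∈ [1, M] and each (u₁, u₂) ∈ U_i there exist w₀, w₁, w₂ ∈ Σ* such that w = w₀u₁w₁u₂w₂ ∈ L and this factorisation is U_i-switchable for L; (2) for every λ ∈ ℕ with λ ≥ 1 there exists N_λ ∈ ℕ such that every w ∈ L carrying a marking with at least N_λ marked positions has, for some i ∈ [1, M], a U_i-switchable factorisation w = w₀u₁w₁u₂w₂ with |w₀|_# + |w₁|_# + |w₂|_# ≥ λ and |u₁|_# + |u₂|_# ≥ μ; (3) there exists N_μ ∈ ℕ such that every w ∈ L carrying a marking with at least N_μ marked positions has, for some i ∈ [1, M], a U_i-switchable factorisation w = w₀u₁w₁u₂w₂ with μ ≤ |u₁|_# + |u₂|_# ≤ N_μ. -/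
/-- `markCount mk s len` is the number of marked positions (elements of `mk`)
falling inside the factor occupying positions `[s, s + len)` of a word. -/
def markCount (mk : Finset ℕ) (s len : ℕ) : ℕ :=
  (mk ∩ Finset.Ico s (s + len)).card

/-- `g.Yields s w`: the sentential form `s` derives the terminal word `w`, with the derivation
organised as a forest of parse trees. -/
inductive ContextFreeGrammar.Yields {T : Type*} (g : ContextFreeGrammar T) :
    List (Symbol T g.NT) → List T → Prop
  | nil : g.Yields [] []
  | terminal (a : T) {s : List (Symbol T g.NT)} {w : List T} (h : g.Yields s w) :
      g.Yields (Symbol.terminal a :: s) (a :: w)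
  | nonterminal {r : ContextFreeRule T g.NT} (hr : r ∈ g.rules) {s : List (Symbol T g.NT)}
      {u w : List T} (hu : g.Yields r.output u) (h : g.Yields s w) :
      g.Yields (Symbol.nonterminal r.input :: s) (u ++ w)

namespace ContextFreeGrammar

variable {T : Type*} {g : ContextFreeGrammar T}

lemma Yields.exists_append {s t : List (Symbol T g.NT)} {w : List T} (h : g.Yields (s ++ t) w) :
    ∃ u v, w = u ++ v ∧ g.Yields s u ∧ g.Yields t v := by
  induction s generalizing w with
  | nil => exact ⟨[], w, rfl, .nil, h⟩
  | cons a s ih =>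
    cases h with
    | terminal a h =>
      obtain ⟨u, v, rfl, hu, hv⟩ := ih h
      exact ⟨a :: u, v, rfl, .terminal a hu, hv⟩
    | nonterminal hr hx h =>
      obtain ⟨u, v, rfl, hu, hv⟩ := ih h
      exact ⟨_ ++ u, v, by simp, .nonterminal hr hx hu, hv⟩

lemma Yields.of_rewrites {r : ContextFreeRule T g.NT} (hr : r ∈ g.rules)
    {s t : List (Symbol T g.NT)} (hst : r.Rewrites s t) {w : List T} (h : g.Yields t w) :
    g.Yields s w := by
  induction hst generalizing w with
  | head s =>
    obtain ⟨u, v, rfl, hu, hv⟩ := h.exists_append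
    exact .nonterminal hr hu hv
  | cons x _ ih =>
    cases h with
    | terminal a h => exact .terminal a (ih h)
    | nonterminal hr' hx h => exact .nonterminal hr' hx (ih h)

lemma yields_map_terminal (w : List T) : g.Yields (w.map Symbol.terminal) w := by
  induction w with
  | nil => exact .nil
  | cons a w ih => exact .terminal a ih

lemma Derives.yields {s : List (Symbol T g.NT)} {w : List T}
    (h : g.Derives s (w.map Symbol.terminal)) : g.Yields s w := by
  induction h using Relation.ReflTransGen.head_induction_on with
  | refl => exact yields_map_terminal w
  | head hst _ ih =>
    obtain ⟨r, hr, hst⟩ := hst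
    exact ih.of_rewrites hr hst

lemma derives_of_mem_rules {r : ContextFreeRule T g.NT} (hr : r ∈ g.rules) :
    g.Derives [Symbol.nonterminal r.input] r.output :=
  Produces.single ⟨r, hr, .input_output⟩

lemma Yields.derives {s : List (Symbol T g.NT)} {w : List T} (h : g.Yields s w) :
    g.Derives s (w.map Symbol.terminal) := by
  induction h with
  | nil => rfl
  | terminal a _ ih => exact ih.append_left [Symbol.terminal a]
  | @nonterminal r hr s u w _ _ ihu ih =>
    have h₁ := ((derives_of_mem_rules hr).trans ihu).append_right s
    have h₂ := ih.append_left (u.map Symbol.terminal)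
    rw [List.map_append]
    exact h₁.trans h₂

/-- `g.Context s x B y`: the sentential form `s` derives `x B y`, where `x` and `y` are terminal
words. -/
def Context (g : ContextFreeGrammar T) (s : List (Symbol T g.NT)) (x : List T) (B : g.NT)
    (y : List T) : Prop :=
  g.Derives s (x.map Symbol.terminal ++ [Symbol.nonterminal B] ++ y.map Symbol.terminal)

lemma Context.refl (A : g.NT) : g.Context [Symbol.nonterminal A] [] A [] :=
  Derives.refl _

lemma Context.derives {s t : List (Symbol T g.NT)} {x y : List T} {B : g.NT}
    (h : g.Context s x B y) (ht : g.Derives [Symbol.nonterminal B] t) :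
    g.Derives s (x.map Symbol.terminal ++ t ++ y.map Symbol.terminal) :=
  Derives.trans h ((ht.append_left _).append_right _)

lemma Context.trans {s : List (Symbol T g.NT)} {x y x' y' : List T} {B C : g.NT}
    (h : g.Context s x B y) (h' : g.Context [Symbol.nonterminal B] x' C y') :
    g.Context s (x ++ x') C (y' ++ y) := by
  have := h.derives h'
  simpa [Context] using this

lemma Context.yields {s : List (Symbol T g.NT)} {x y w : List T} {B : g.NT}
    (h : g.Context s x B y) (hw : g.Yields [Symbol.nonterminal B] w) :
    g.Yields s (x ++ w ++ y) := by
  refine Derives.yields ?_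
  simpa using h.derives hw.derives

lemma Context.prepend {s t : List (Symbol T g.NT)} {u x y : List T} {B : g.NT}
    (ht : g.Derives t (u.map Symbol.terminal)) (h : g.Context s x B y) :
    g.Context (t ++ s) (u ++ x) B y := by
  have h₁ := (ht.append_right s).trans (Derives.append_left h (u.map Symbol.terminal))
  simpa [Context] using h₁

lemma Context.append {s t : List (Symbol T g.NT)} {u x y : List T} {B : g.NT}
    (h : g.Context s x B y) (ht : g.Derives t (u.map Symbol.terminal)) :
    g.Context (s ++ t) x B (y ++ u) := by
  have h₁ := (Derives.append_right h t).trans (ht.append_left _)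
  simpa [Context] using h₁

/-- The pairs of terminal words `(u, v)` with `A ⇒* u A v`. -/
def loops (g : ContextFreeGrammar T) (A : g.NT) : Set (List T × List T) :=
  {p | g.Context [Symbol.nonterminal A] p.1 A p.2}

lemma loops_infinite {A : g.NT} {p : List T × List T} (hp : p ∈ g.loops A)
    (hpos : 0 < p.1.length + p.2.length) : (g.loops A).Infinite := by
  have key : ∀ n : ℕ, ∃ q ∈ g.loops A, n ≤ q.1.length + q.2.length := by
    intro n
    induction n with
    | zero => exact ⟨p, hp, Nat.zero_le _⟩
    | succ n ih =>
      obtain ⟨q, hq, hn⟩ := ih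
      refine ⟨(p.1 ++ q.1, q.2 ++ p.2), Context.trans hp hq, ?_⟩
      simp only [List.length_append]
      omega
  refine Set.Infinite.of_image (fun q => q.1.length + q.2.length)
    (Set.infinite_of_forall_exists_gt fun n => ?_)
  obtain ⟨q, hq, hn⟩ := key (n + 1)
  exact ⟨_, Set.mem_image_of_mem _ hq, hn⟩

end ContextFreeGrammar

lemma markCount_add (mk : Finset ℕ) (s a b : ℕ) :
    markCount mk s (a + b) = markCount mk s a + markCount mk (s + a) b := by
  unfold markCount
  rw [← Finset.card_union_of_disjoint, ← Finset.inter_union_distrib_left, ← Nat.add_assoc,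
    Finset.Ico_union_Ico_eq_Ico (by omega) (by omega)]
  exact (Finset.Ico_disjoint_Ico_consecutive _ _ _).mono Finset.inter_subset_right
    Finset.inter_subset_right

lemma markCount_le (mk : Finset ℕ) (s a : ℕ) : markCount mk s a ≤ a :=
  (Finset.card_le_card Finset.inter_subset_right).trans (by simp)

lemma markCount_zero_of_subset_range {mk : Finset ℕ} {n : ℕ} (h : mk ⊆ Finset.range n) :
    markCount mk 0 n = mk.card := by
  unfold markCount
  rw [Nat.zero_add, Nat.Ico_zero_eq_range, Finset.inter_eq_left.2 h]

namespace ContextFreeGrammar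

variable {T : Type*} {g : ContextFreeGrammar T}

/-- A parse forest with many marked leaves contains a subtree whose number of marked leaves lies in
a prescribed window. -/
lemma Yields.exists_subtree {d : ℕ} (hd : ∀ r ∈ g.rules, r.output.length ≤ d) (mk : Finset ℕ)
    {t : ℕ} (ht : 1 ≤ t) {s : List (Symbol T g.NT)} {w : List T} (h : g.Yields s w) (o : ℕ)
    (hc : t * s.length < markCount mk o w.length) :
    ∃ B ∈ ContextFreeRule.input '' (g.rules : Set (ContextFreeRule T g.NT)), ∃ x v y,
      w = x ++ v ++ y ∧ g.Context s x B y ∧ g.Yields [Symbol.nonterminal B] v ∧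
      t < markCount mk (o + x.length) v.length ∧
      markCount mk (o + x.length) v.length ≤ t * d := by
  induction h generalizing o with
  | nil => simp [markCount] at hc
  | @terminal a s w h ih =>
    have hadd := markCount_add mk o 1 w.length
    have hle := markCount_le mk o 1
    rw [List.length_cons, List.length_cons, Nat.mul_succ, Nat.add_comm w.length] at hc
    obtain ⟨B, hB, x, v, y, rfl, hx, hv, h₁, h₂⟩ := ih (o + 1) (by omega)
    refine ⟨B, hB, a :: x, v, y, by simp,
      hx.prepend (u := [a]) (t := [Symbol.terminal a]) (Derives.refl _), hv, ?_⟩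
    rw [List.length_cons, Nat.add_comm x.length, ← Nat.add_assoc]
    exact ⟨h₁, h₂⟩
  | @nonterminal r hr s u w hu h ihu ih =>
    rw [List.length_cons, Nat.mul_succ, List.length_append, markCount_add] at hc
    have hr' : g.Yields [Symbol.nonterminal r.input] u := by
      simpa using Yields.nonterminal hr hu .nil
    by_cases hw : t * s.length < markCount mk (o + u.length) w.length
    · obtain ⟨B, hB, x, v, y, rfl, hx, hv, h₁⟩ := ih _ hw
      refine ⟨B, hB, u ++ x, v, y, by simp, hx.prepend hr'.derives, hv, ?_⟩
      rwa [List.length_append, ← Nat.add_assoc]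
    by_cases hu' : markCount mk o u.length ≤ t * d
    · refine ⟨r.input, ⟨r, hr, rfl⟩, [], u, w, by simp, ?_, hr', ?_⟩
      · simpa using (Context.refl r.input).append h.derives
      · simp only [List.length_nil, Nat.add_zero]
        omega
    · have := Nat.mul_le_mul_left t (hd r hr)
      obtain ⟨B, hB, x, v, y, rfl, hx, hv, h₁⟩ := ihu o (by omega)
      refine ⟨B, hB, x, v, y ++ w, by simp, ?_, hv, h₁⟩
      exact Context.append (s := [Symbol.nonterminal r.input])
        ((derives_of_mem_rules hr).trans hx) h.derives

/-- A labelled factor `(A, o, v)` is a nonterminal `A` together with a word `v` at position `o`.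
`g.Below p q` says that `q` occurs inside `p` in a way witnessed by a derivation of `g`. -/
def Below (g : ContextFreeGrammar T) (p q : g.NT × ℕ × List T) : Prop :=
  ∃ x y, g.Context [Symbol.nonterminal p.1] x q.1 y ∧ p.2.2 = x ++ q.2.2 ++ y ∧
    q.2.1 = p.2.1 + x.length

lemma Below.trans {p q r : g.NT × ℕ × List T} (hpq : g.Below p q) (hqr : g.Below q r) :
    g.Below p r := by
  obtain ⟨x, y, hx, hw, ho⟩ := hpq
  obtain ⟨x', y', hx', hw', ho'⟩ := hqr
  refine ⟨x ++ x', y' ++ y, hx.trans hx', by simp [hw, hw'], ?_⟩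
  rw [ho', ho, List.length_append, Nat.add_assoc]

/-- A parse tree with many marked leaves contains a chain of nested subtrees whose numbers of marked
leaves lie in prescribed windows. -/
lemma exists_chain {d : ℕ} (hd : ∀ r ∈ g.rules, r.output.length ≤ d) (mk : Finset ℕ)
    {τ : ℕ → ℕ} (hτ : Monotone τ) (hτ₀ : 1 ≤ τ 0) (k : ℕ) (p : g.NT × ℕ × List T)
    (hp : g.Yields [Symbol.nonterminal p.1] p.2.2)
    (hc : τ k < markCount mk p.2.1 p.2.2.length) :
    ∃ f : ℕ → g.NT × ℕ × List T, ∀ j ≤ k, g.Below p (f j) ∧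
      (f j).1 ∈ ContextFreeRule.input '' (g.rules : Set (ContextFreeRule T g.NT)) ∧
      g.Yields [Symbol.nonterminal (f j).1] (f j).2.2 ∧
      τ j < markCount mk (f j).2.1 (f j).2.2.length ∧
      markCount mk (f j).2.1 (f j).2.2.length ≤ τ j * d ∧
      ∀ i < j, g.Below (f j) (f i) := by
  induction k generalizing p with
  | zero =>
    obtain ⟨B, hB, x, v, y, hw, hx, hv, h₁, h₂⟩ :=
      hp.exists_subtree hd mk hτ₀ p.2.1 (by simpa using hc)
    refine ⟨fun _ => (B, p.2.1 + x.length, v), fun j hj => ?_⟩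
    obtain rfl : j = 0 := by omega
    exact ⟨⟨x, y, hx, hw, rfl⟩, hB, hv, h₁, h₂, fun i hi => absurd hi (Nat.not_lt_zero i)⟩
  | succ k ih =>
    obtain ⟨B, hB, x, v, y, hw, hx, hv, h₁, h₂⟩ :=
      hp.exists_subtree hd mk (hτ₀.trans (hτ (Nat.zero_le (k + 1)))) p.2.1 (by simpa using hc)
    obtain ⟨f, hf⟩ := ih (B, p.2.1 + x.length, v) hv ((hτ (Nat.le_succ k)).trans_lt h₁)
    have hpq : g.Below p (B, p.2.1 + x.length, v) := ⟨x, y, hx, hw, rfl⟩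
    refine ⟨fun j => if j ≤ k then f j else (B, p.2.1 + x.length, v), fun j hj => ?_⟩
    by_cases hjk : j ≤ k
    · obtain ⟨h₃, h₄, h₅, h₆, h₇, h₈⟩ := hf j hjk
      simp only [hjk, if_true]
      refine ⟨hpq.trans h₃, h₄, h₅, h₆, h₇, fun i hi => ?_⟩
      simp only [show i ≤ k by omega, if_true]
      exact h₈ i hi
    · obtain rfl : j = k + 1 := by omega
      simp only [hjk, if_false]
      refine ⟨hpq, hB, hv, h₁, h₂, fun i hi => ?_⟩
      simp only [show i ≤ k by omega, if_true]
      exact (hf i (by omega)).1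

/-- The window sizes used to separate nested subtrees by at least `μ` marked leaves. -/
def threshold (d μ : ℕ) : ℕ → ℕ
  | 0 => 1
  | k + 1 => threshold d μ k * d + μ

lemma threshold_monotone {d : ℕ} (hd : 1 ≤ d) (μ : ℕ) : Monotone (threshold d μ) :=
  monotone_nat_of_le_succ fun k => by
    have := Nat.le_mul_of_pos_right (threshold d μ k) hd
    simp only [threshold]
    omega

/-- Every word of the language with many marked positions has a factorisation through a loop
`A ⇒* u₁ A u₂` containing at least `μ`, but a bounded number of, marked positions. -/
theorem exists_marked_loop (g : ContextFreeGrammar T) (μ : ℕ) :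
    ∃ N : ℕ, ∀ w ∈ g.language, ∀ mk : Finset ℕ, mk ⊆ Finset.range w.length → N ≤ mk.card →
      ∃ A ∈ ContextFreeRule.input '' (g.rules : Set (ContextFreeRule T g.NT)),
      ∃ w₀ u₁ w₁ u₂ w₂ : List T, w = w₀ ++ u₁ ++ w₁ ++ u₂ ++ w₂ ∧
        g.Context [Symbol.nonterminal g.initial] w₀ A w₂ ∧ (u₁, u₂) ∈ g.loops A ∧
        g.Yields [Symbol.nonterminal A] w₁ ∧
        μ ≤ markCount mk w₀.length u₁.length
          + markCount mk (w₀.length + u₁.length + w₁.length) u₂.length ∧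
        markCount mk w₀.length u₁.length
          + markCount mk (w₀.length + u₁.length + w₁.length) u₂.length ≤ N := by
  classical
  obtain ⟨d, hd₀, hd⟩ : ∃ d, 1 ≤ d ∧ ∀ r ∈ g.rules, r.output.length ≤ d :=
    ⟨g.rules.sup (fun r => r.output.length) + 1, Nat.le_add_left 1 _, fun r hr =>
      (Finset.le_sup (f := fun r : ContextFreeRule T g.NT => r.output.length) hr).trans
        (Nat.le_succ _)⟩
  set S := g.rules.image ContextFreeRule.input
  have hmono := threshold_monotone hd₀ μ
  refine ⟨threshold d μ (S.card + 1) + 1, fun w hw mk hmk hN => ?_⟩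
  have hmk' := markCount_zero_of_subset_range hmk
  have hlt : threshold d μ S.card < markCount mk 0 w.length := by
    have := hmono (Nat.le_add_right S.card 1)
    omega
  obtain ⟨f, hf⟩ := exists_chain hd mk hmono le_rfl S.card (g.initial, 0, w)
    (Derives.yields hw) hlt
  obtain ⟨i, j, hij, hj, hfij⟩ :
      ∃ i j, i < j ∧ j ≤ S.card ∧ (f i).1 = (f j).1 := by
    obtain ⟨i, hi, j, hj, hne, h⟩ := Finset.exists_ne_map_eq_of_card_lt_of_maps_to
      (s := Finset.range (S.card + 1)) (t := S) (f := fun k => (f k).1) (by simp)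
      (fun k hk => by
        have hk' : k ≤ S.card := by
          have := Finset.mem_range.1 hk
          omega
        obtain ⟨r, hr, hrk⟩ := (hf k hk').2.1
        exact Finset.mem_image.2 ⟨r, hr, hrk⟩)
    rw [Finset.mem_range] at hi hj
    rcases lt_or_gt_of_ne hne with hlt | hlt
    · exact ⟨i, j, hlt, by omega, h⟩
    · exact ⟨j, i, hlt, by omega, h.symm⟩
  obtain ⟨⟨w₀, w₂, hctx, hw, ho⟩, hmem, -, hj₁, hj₂, hbelow⟩ := hf j hj
  obtain ⟨-, -, hy, hi₁, hi₂, -⟩ := hf i (hij.le.trans hj)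
  obtain ⟨u₁, u₂, hloop, hv, ho'⟩ := hbelow i hij
  rw [hfij] at hloop hy
  simp only at hw ho hctx
  rw [ho', ho] at hi₁ hi₂
  rw [hv, ho, List.length_append, List.length_append, markCount_add, markCount_add] at hj₁ hj₂
  simp only [Nat.zero_add, ← Nat.add_assoc] at hi₁ hi₂ hj₁ hj₂
  refine ⟨(f j).1, hmem, w₀, u₁, (f i).2.2, u₂, w₂, by simp [hw, hv], hctx, hloop, hy, ?_, ?_⟩
  · have h₁ := hmono (show i + 1 ≤ j from hij)
    simp only [threshold] at h₁
    omega
  · have h₁ := Nat.mul_le_mul_right d (hmono hj)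
    simp only [threshold]
    omega

end ContextFreeGrammar

/-- Substitution lemma for context-free languages: for an infinite context-free
language `L` over a finite alphabet and every `μ ≥ 1`, there exist `M ≥ 1` and
infinite sets `U₁, …, U_M ⊆ (Σ*)²` such that:
(1) every tuple of every `U i` occurs in a `U i`-switchable factorisation of
some word of `L`;
(2) for every `λ ≥ 1` there is `N_λ` such that every word of `L` with at least
`N_λ` marked positions has a `U i`-switchable factorisation
`w = w₀ u₁ w₁ u₂ w₂` with `|w₀|_# + |w₁|_# + |w₂|_# ≥ λ` and
`|u₁|_# + |u₂|_# ≥ μ`;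
(3) there is `N_μ` such that every word of `L` with at least `N_μ` marked
positions has a `U i`-switchable factorisation with
`μ ≤ |u₁|_# + |u₂|_# ≤ N_μ`. -/
theorem substitution_lemma_contextFree {σ : Type} [Fintype σ]
    (L : Language σ) (hcf : L.IsContextFree) (hinf : L.Infinite)
    (μ : ℕ) (hμ : 1 ≤ μ) :
    ∃ M : ℕ, 1 ≤ M ∧ ∃ U : Fin M → Set (List σ × List σ),
      (∀ i, (U i).Infinite) ∧
      -- (1)
      (∀ i, ∀ p ∈ U i, ∃ w₀ w₁ w₂ : List σ,
        w₀ ++ p.1 ++ w₁ ++ p.2 ++ w₂ ∈ L ∧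
        ∀ q ∈ U i, w₀ ++ q.1 ++ w₁ ++ q.2 ++ w₂ ∈ L) ∧
      -- (2)
      (∀ lam : ℕ, 1 ≤ lam → ∃ N : ℕ, ∀ w ∈ L, ∀ mk : Finset ℕ,
        mk ⊆ Finset.range w.length → N ≤ mk.card →
        ∃ i : Fin M, ∃ w₀ u₁ w₁ u₂ w₂ : List σ,
          w = w₀ ++ u₁ ++ w₁ ++ u₂ ++ w₂ ∧ (u₁, u₂) ∈ U i ∧
          (∀ q ∈ U i, w₀ ++ q.1 ++ w₁ ++ q.2 ++ w₂ ∈ L) ∧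
          lam ≤ markCount mk 0 w₀.length
              + markCount mk (w₀.length + u₁.length) w₁.length
              + markCount mk (w₀.length + u₁.length + w₁.length + u₂.length)
                  w₂.length ∧
          μ ≤ markCount mk w₀.length u₁.length
              + markCount mk (w₀.length + u₁.length + w₁.length) u₂.length) ∧
      -- (3)
      (∃ Nμ : ℕ, ∀ w ∈ L, ∀ mk : Finset ℕ,
        mk ⊆ Finset.range w.length → Nμ ≤ mk.card →
        ∃ i : Fin M, ∃ w₀ u₁ w₁ u₂ w₂ : List σ,
          w = w₀ ++ u₁ ++ w₁ ++ u₂ ++ w₂ ∧ (u₁, u₂) ∈ U i ∧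
          (∀ q ∈ U i, w₀ ++ q.1 ++ w₁ ++ q.2 ++ w₂ ∈ L) ∧
          μ ≤ markCount mk w₀.length u₁.length
              + markCount mk (w₀.length + u₁.length + w₁.length) u₂.length ∧
          markCount mk w₀.length u₁.length
              + markCount mk (w₀.length + u₁.length + w₁.length) u₂.length
            ≤ Nμ) := by
  classical
  obtain ⟨g, rfl⟩ := hcf
  obtain ⟨N, hN⟩ := g.exists_marked_loop μ
  set I : Set g.NT := {A | A ∈ ContextFreeRule.input '' (g.rules : Set (ContextFreeRule σ g.NT)) ∧
    (g.loops A).Infinite ∧ ∃ w₀ w₁ w₂, g.Context [Symbol.nonterminal g.initial] w₀ A w₂ ∧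
      g.Yields [Symbol.nonterminal A] w₁}
  have hIfin : I.Finite := (g.rules.finite_toSet.image _).subset fun A hA => hA.1
  have hswitch : ∀ {A : g.NT} {w₀ w₁ w₂ : List σ},
      g.Context [Symbol.nonterminal g.initial] w₀ A w₂ → g.Yields [Symbol.nonterminal A] w₁ →
      ∀ q ∈ g.loops A, w₀ ++ q.1 ++ w₁ ++ q.2 ++ w₂ ∈ g.language := by
    intro A w₀ w₁ w₂ h₀ h₁ q hq
    have := ((h₀.trans hq).yields h₁).derives
    simpa [ContextFreeGrammar.mem_language_iff] using this
  have key : ∀ w ∈ g.language, ∀ mk : Finset ℕ, mk ⊆ Finset.range w.length → N ≤ mk.card →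
      ∃ A ∈ I, ∃ w₀ u₁ w₁ u₂ w₂ : List σ, w = w₀ ++ u₁ ++ w₁ ++ u₂ ++ w₂ ∧
        (u₁, u₂) ∈ g.loops A ∧
        (∀ q ∈ g.loops A, w₀ ++ q.1 ++ w₁ ++ q.2 ++ w₂ ∈ g.language) ∧
        μ ≤ markCount mk w₀.length u₁.length
          + markCount mk (w₀.length + u₁.length + w₁.length) u₂.length ∧
        markCount mk w₀.length u₁.length
          + markCount mk (w₀.length + u₁.length + w₁.length) u₂.length ≤ N := by
    intro w hw mk hmk hcard
    obtain ⟨A, hA, w₀, u₁, w₁, u₂, w₂, hfac, hctx, hloop, hy, h₁, h₂⟩ := hN w hw mk hmk hcard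
    have hu₁ := markCount_le mk w₀.length u₁.length
    have hu₂ := markCount_le mk (w₀.length + u₁.length + w₁.length) u₂.length
    have hpos : 0 < u₁.length + u₂.length := by omega
    exact ⟨A, ⟨hA, ContextFreeGrammar.loops_infinite hloop hpos, w₀, w₁, w₂, hctx, hy⟩,
      w₀, u₁, w₁, u₂, w₂, hfac, hloop, hswitch hctx hy, h₁, h₂⟩
  have hne : I.Nonempty := by
    obtain ⟨w, hw, hlen⟩ : ∃ w ∈ g.language, N ≤ w.length := by
      by_contra! hlt
      exact hinf ((List.finite_length_lt σ N).subset hlt)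
    obtain ⟨A, hA, -⟩ := key w hw (Finset.range w.length) subset_rfl (by simpa using hlen)
    exact ⟨A, hA⟩
  have := hIfin.fintype
  have := hne.to_subtype
  let e := Fintype.equivFin I
  refine ⟨Fintype.card I, Fintype.card_pos, fun i => g.loops (e.symm i),
    fun i => (e.symm i).2.2.1, fun i p hp => ?_, fun lam _ => ⟨N + lam, fun w hw mk hmk hc => ?_⟩,
    N, fun w hw mk hmk hc => ?_⟩
  · obtain ⟨w₀, w₁, w₂, hctx, hy⟩ := (e.symm i).2.2.2
    exact ⟨w₀, w₁, w₂, hswitch hctx hy p hp, hswitch hctx hy⟩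
  · obtain ⟨A, hA, w₀, u₁, w₁, u₂, w₂, hfac, hu, hsw, h₁, h₂⟩ := key w hw mk hmk (by omega)
    refine ⟨e ⟨A, hA⟩, w₀, u₁, w₁, u₂, w₂, hfac, by simpa using hu, by simpa using hsw, ?_, h₁⟩
    have htotal := markCount_zero_of_subset_range hmk
    rw [hfac] at htotal
    simp only [List.length_append, markCount_add, Nat.zero_add, ← Nat.add_assoc] at htotal
    omega
  · obtain ⟨A, hA, w₀, u₁, w₁, u₂, w₂, hfac, hu, hsw, h₁, h₂⟩ := key w hw mk hmk hc
    exact ⟨e ⟨A, hA⟩, w₀, u₁, w₁, u₂, w₂, hfac, by simpa using hu, by simpa using hsw, h₁, h₂⟩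
end

section
/- Let m, n ∈ ℕ with m, n ≥ 1, let a₁, …, a_{2m+1} be 2m+1 pairwise distinct letters of an alphabet Σ, let S_m = {a₁^j a₂^j ⋯ a_{2m+1}^j : j ∈ ℕ}, and let w = a₁^n a₂^n ⋯ a_{2m+1}^n. Then for every factorisation w = x y z with 1 ≤ |y| < n, the word xz does not belong to S_m. (In particular, w is not (1, N)-pumpable in S_m for any N < n.) -/
/-- The language `S_m = {a₁^j a₂^j ⋯ a_{2m+1}^j : j ∈ ℕ}` determined by the
letters `a 0, …, a (2m)`. -/
def Slang {σ : Type*} (m : ℕ) (a : Fin (2 * m + 1) → σ) : Set (List σ) :=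
  {w | ∃ j : ℕ, w = (List.ofFn fun i : Fin (2 * m + 1) =>
    List.replicate j (a i)).flatten}

theorem count_flatten_ofFn_replicate {σ : Type*} [DecidableEq σ] {k : ℕ} (n : ℕ)
    {a : Fin k → σ} (ha : Function.Injective a) (i : Fin k) :
    (List.ofFn fun i => List.replicate n (a i)).flatten.count (a i) = n := by
  simp [List.count_flatten, List.map_ofFn, List.sum_ofFn, List.count_replicate, ha.eq_iff]

theorem length_flatten_ofFn_replicate {σ : Type*} {k : ℕ} (n : ℕ) (a : Fin k → σ) :
    (List.ofFn fun i => List.replicate n (a i)).flatten.length = k * n := by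
  simp [List.length_flatten, List.map_ofFn, List.sum_ofFn]

theorem replicate_prefix_flatten_ofFn {σ : Type*} {k : ℕ} (n : ℕ) (a : Fin (k + 1) → σ) :
    List.replicate n (a 0) <+: (List.ofFn fun i => List.replicate n (a i)).flatten := by
  rw [List.ofFn_succ, List.flatten_cons]
  exact List.prefix_append _ _

theorem replicate_suffix_flatten_ofFn {σ : Type*} {k : ℕ} (n : ℕ) (a : Fin (k + 1) → σ) :
    List.replicate n (a (Fin.last k)) <:+
      (List.ofFn fun i => List.replicate n (a i)).flatten := by
  rw [List.ofFn_succ', List.concat_eq_append, List.flatten_append, List.flatten_singleton]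
  exact List.suffix_append _ _

/-- For `m, n ≥ 1` and pairwise distinct letters `a₁, …, a_{2m+1}`, if
`w = a₁^n ⋯ a_{2m+1}^n = x y z` with `1 ≤ |y| < n`, then `x z ∉ S_m`.
In particular `w` is not `(1, N)`-pumpable in `S_m` for any `N < n`. -/
theorem remove_factor_not_mem_Slang {σ : Type*} (m n : ℕ) (hm : 1 ≤ m)
    (hn : 1 ≤ n) (a : Fin (2 * m + 1) → σ) (ha : Function.Injective a)
    (x y z : List σ)
    (hw : (List.ofFn fun i : Fin (2 * m + 1) =>
      List.replicate n (a i)).flatten = x ++ y ++ z)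
    (hy1 : 1 ≤ y.length) (hy2 : y.length < n) :
    x ++ z ∉ Slang m a := by
  classical
  rintro ⟨j, hj⟩
  have hlw := congrArg List.length hw
  have hlj := congrArg List.length hj
  rw [length_flatten_ofFn_replicate] at hlw hlj
  simp only [List.length_append] at hlw hlj
  have hjn : j < n := by
    by_contra! h
    have := Nat.mul_le_mul_left (2 * m + 1) h
    omega
  have hcount (i : Fin (2 * m + 1)) : x.count (a i) + z.count (a i) < n := by
    have h := congrArg (List.count (a i)) hj
    rw [count_flatten_ofFn_replicate j ha, List.count_append] at h
    omega
  have hx : x.length < n := by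
    by_contra! h
    have hp : List.replicate n (a 0) <+: x := by
      refine List.prefix_of_prefix_length_le (replicate_prefix_flatten_ofFn n a) ?_ (by simpa)
      rw [hw, List.append_assoc]
      exact List.prefix_append _ _
    have := hp.sublist.count_le (a 0)
    rw [List.count_replicate_self] at this
    have := hcount 0
    omega
  have hz : z.length < n := by
    by_contra! h
    have hs : List.replicate n (a (Fin.last (2 * m))) <:+ z := by
      refine List.suffix_of_suffix_length_le (replicate_suffix_flatten_ofFn n a) ?_ (by simpa)
      rw [hw]
      exact List.suffix_append _ _
    have := hs.sublist.count_le (a (Fin.last (2 * m)))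
    rw [List.count_replicate_self] at this
    have := hcount (Fin.last (2 * m))
    omega
  have : 3 * n ≤ (2 * m + 1) * n := Nat.mul_le_mul_right n (by omega)
  omega
end

section
/- Let L₁ = {(a^p b^p)^q : p, q ∈ ℕ, p, q ≥ 1} over the alphabet {a, b}. For all m, n ∈ ℕ with n ≥ 2, and every factorisation (a^m b^m)^n = x y z with 1 ≤ |y| < m, the word xz does not belong to L₁. (In particular, (a^m b^m)^n is not (1, N)-pumpable in L₁ for any N < m.) -/
/-- `wordPow u n` is the `n`-fold concatenation `u^n` of the word `u`. -/
def wordPow {σ : Type*} (u : List σ) (n : ℕ) : List σ :=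
  (List.replicate n u).flatten

/-- The language `L₁ = {(a^p b^p)^q : p, q ≥ 1}` over the two-letter alphabet
`Fin 2` (with `a = 0`, `b = 1`). -/
def Lab : Set (List (Fin 2)) :=
  {w | ∃ p q : ℕ, 1 ≤ p ∧ 1 ≤ q ∧
    w = wordPow (List.replicate p (0 : Fin 2) ++ List.replicate p (1 : Fin 2)) q}

theorem wordPow_length {σ : Type*} (u : List σ) (n : ℕ) :
    (wordPow u n).length = n * u.length := by
  simp [wordPow]

theorem wordPow_reverse {σ : Type*} (u : List σ) (n : ℕ) :
    (wordPow u n).reverse = wordPow u.reverse n := by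
  simp [wordPow, List.reverse_flatten]

/-- A nonempty power of `c^m d^m` with `m ≥ 1` begins with `c^m d`. -/
theorem exists_wordPow_eq_replicate_append_cons {σ : Type*} (c d : σ) {m n : ℕ}
    (hm : 1 ≤ m) (hn : 1 ≤ n) :
    ∃ r, wordPow (List.replicate m c ++ List.replicate m d) n
      = List.replicate m c ++ d :: r := by
  obtain ⟨m, rfl⟩ := Nat.exists_eq_add_of_le' hm
  obtain ⟨n, rfl⟩ := Nat.exists_eq_add_of_le' hn
  refine ⟨List.replicate m d ++
    wordPow (List.replicate (m + 1) c ++ List.replicate (m + 1) d) n, ?_⟩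
  rw [wordPow, List.replicate_succ, List.flatten_cons, ← wordPow]
  conv_lhs => enter [1, 2]; rw [List.replicate_succ]
  simp

/-- The length of the leading run of `c` is determined by any prefix extending past it. -/
theorem leading_run_unique {σ : Type*} {c d : σ} (hcd : c ≠ d) :
    ∀ {m p : ℕ} {x t z r s : List σ}, m < x.length →
      x ++ t = List.replicate m c ++ d :: r →
      x ++ z = List.replicate p c ++ d :: s → m = p
  | _, _, [], _, _, _, _, hx, _, _ => by simp at hx
  | 0, 0, _ :: _, _, _, _, _, _, _, _ => rfl
  | 0, p + 1, _ :: _, _, _, _, _, _, h₁, h₂ => by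
    simp [List.replicate_succ] at h₁ h₂
    exact absurd (h₂.1.symm.trans h₁.1) hcd
  | m + 1, 0, _ :: _, _, _, _, _, _, h₁, h₂ => by
    simp [List.replicate_succ] at h₁ h₂
    exact absurd (h₁.1.symm.trans h₂.1) hcd
  | m + 1, p + 1, _ :: _, _, _, _, _, hx, h₁, h₂ => by
    simp only [List.replicate_succ, List.cons_append, List.cons.injEq] at h₁ h₂
    rw [leading_run_unique hcd (by simpa using hx) h₁.2 h₂.2]

/-- If powers of `c^m d^m` and `c^p d^p` share a prefix longer than `m`, then `m = p`. -/
theorem eq_of_wordPow_common_prefix {σ : Type*} {c d : σ} (hcd : c ≠ d) {m n p q : ℕ}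
    (hm : 1 ≤ m) (hn : 1 ≤ n) (hp : 1 ≤ p) (hq : 1 ≤ q) {x t z : List σ}
    (hx : m < x.length)
    (h₁ : wordPow (List.replicate m c ++ List.replicate m d) n = x ++ t)
    (h₂ : wordPow (List.replicate p c ++ List.replicate p d) q = x ++ z) : m = p := by
  obtain ⟨r, hr⟩ := exists_wordPow_eq_replicate_append_cons c d hm hn
  obtain ⟨s, hs⟩ := exists_wordPow_eq_replicate_append_cons c d hp hq
  exact leading_run_unique hcd hx (h₁.symm.trans hr) (h₂.symm.trans hs)

/-- For all `m, n` with `n ≥ 2`, if `(a^m b^m)^n = x y z` with `1 ≤ |y| < m`,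
then `x z ∉ L₁`. In particular `(a^m b^m)^n` is not `(1, N)`-pumpable in `L₁`
for any `N < m`. -/
theorem remove_factor_not_mem_Lab (m n : ℕ) (hn : 2 ≤ n)
    (x y z : List (Fin 2))
    (hw : wordPow (List.replicate m (0 : Fin 2) ++ List.replicate m (1 : Fin 2)) n
      = x ++ y ++ z)
    (hy1 : 1 ≤ y.length) (hy2 : y.length < m) :
    x ++ z ∉ Lab := by
  rintro ⟨p, q, hp, hq, hv⟩
  have hlw := congrArg List.length hw
  have hlv := congrArg List.length hv
  simp only [wordPow_length, List.length_append, List.length_replicate] at hlw hlv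
  have hmp : m = p := by
    rcases lt_or_ge m x.length with hx | hx
    · rw [List.append_assoc] at hw
      exact eq_of_wordPow_common_prefix zero_ne_one (by omega) (by omega) hp hq hx hw hv.symm
    · have hz : m < z.reverse.length := by
        rw [List.length_reverse]
        nlinarith
      have hw' := congrArg List.reverse hw
      have hv' := congrArg List.reverse hv.symm
      simp only [wordPow_reverse, List.reverse_append, List.reverse_replicate] at hw' hv'
      exact eq_of_wordPow_common_prefix one_ne_zero (by omega) (by omega) hp hq hz hw' hv'
  subst hmp
  rcases le_or_gt n q with h | h
  · have := Nat.mul_le_mul_right (m + m) h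
    omega
  · have := Nat.mul_le_mul_right (m + m) (Nat.succ_le_of_lt h)
    rw [Nat.succ_mul] at this
    omega
end

section
/- Let G = F₂ × F₂ where F₂ is the free group on two generators, with the first factor freely generated by g_a, g_b and the second by g_c, g_d. Let Σ = {a, b, c, d, a⁻¹, b⁻¹, c⁻¹, d⁻¹} and let π : Σ* → G be the monoid homomorphism with π(a) = (g_a, 1), π(b) = (g_b, 1), π(c) = (1, g_c), π(d) = (1, g_d), and each inverse letter mapped to the inverse of the corresponding element. Let n, t ≥ 1, let x₁, …, x_n, y₁, …, y_n, q₁, …, q_t, p₁, …, p_{t+1} be positive integers, and let w = (ca)^{x₁}(db)^{y₁}⋯(ca)^{x_n}(db)^{y_n} · (b⁻¹)^{p₁} · (d⁻¹a⁻¹)^{q₁}(c⁻¹b⁻¹)^{p₂}⋯(c⁻¹b⁻¹)^{p_t}(d⁻¹a⁻¹)^{q_t} · (c⁻¹)^{p_{t+1}} ∈ Σ*. Then π(w) = 1 in G if and only if n = t and there exists m ≥ 1 such that every exponent x_i, y_i, p_j, q_j equals m; that is, if and only if w = ((ca)^m(db)^m)^n (b⁻¹)^m ((d⁻¹a⁻¹)^m(c⁻¹b⁻¹)^m)^{n−1}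 (d⁻¹a⁻¹)^m (c⁻¹)^m for some m, n ≥ 1. -/
/-- The alphabet `Σ = {a, b, c, d, a⁻¹, b⁻¹, c⁻¹, d⁻¹}`. -/
inductive Letter : Type
  | a | b | c | d | A | B | C | D
  deriving DecidableEq

open Letter

/-- The free group of rank 2. -/
abbrev F2 : Type := FreeGroup (Fin 2)

/-- The group `G = F₂ × F₂`; the first factor is freely generated by
`g_a = FreeGroup.of 0`, `g_b = FreeGroup.of 1`, and the second factor by
`g_c = FreeGroup.of 0`, `g_d = FreeGroup.of 1`. -/
abbrev Gp : Type := F2 × F2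

/-- The value of the projection `π` on each letter. -/
def letterVal : Letter → Gp
  | Letter.a => (FreeGroup.of 0, 1)
  | Letter.b => (FreeGroup.of 1, 1)
  | Letter.c => (1, FreeGroup.of 0)
  | Letter.d => (1, FreeGroup.of 1)
  | Letter.A => ((FreeGroup.of 0)⁻¹, 1)
  | Letter.B => ((FreeGroup.of 1)⁻¹, 1)
  | Letter.C => (1, (FreeGroup.of 0)⁻¹)
  | Letter.D => (1, (FreeGroup.of 1)⁻¹)

/-- The monoid homomorphism `π : Σ* → G` induced by `letterVal`. -/
def π : FreeMonoid Letter →* Gp := FreeMonoid.lift letterVal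

/-- The word
`(ca)^{x₁}(db)^{y₁}⋯(ca)^{x_n}(db)^{y_n} (b⁻¹)^{p₁}
 (d⁻¹a⁻¹)^{q₁}(c⁻¹b⁻¹)^{p₂}⋯(c⁻¹b⁻¹)^{p_t}(d⁻¹a⁻¹)^{q_t} (c⁻¹)^{p_{t+1}}`
(exponents given by the functions `x y q p : ℕ → ℕ`, indexed from 1). -/
def bigWord (n t : ℕ) (x y q p : ℕ → ℕ) : FreeMonoid Letter :=
  ((List.range n).map fun i =>
      (FreeMonoid.of c * FreeMonoid.of a) ^ x (i + 1) *
      (FreeMonoid.of d * FreeMonoid.of b) ^ y (i + 1)).prod *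
  (FreeMonoid.of B) ^ p 1 *
  (FreeMonoid.of D * FreeMonoid.of A) ^ q 1 *
  ((List.range (t - 1)).map fun j =>
      (FreeMonoid.of C * FreeMonoid.of B) ^ p (j + 2) *
      (FreeMonoid.of D * FreeMonoid.of A) ^ q (j + 2)).prod *
  (FreeMonoid.of C) ^ p (t + 1)

/-- The positive word `0^{x₁} 1^{y₁} 0^{x₂} 1^{y₂} ⋯` with the given blocks of exponents. -/
def blockWord (l : List (ℕ × ℕ)) : List (Fin 2) :=
  l.flatMap fun e => List.replicate e.1 0 ++ List.replicate e.2 1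

theorem replicate_append_inj {α : Type*} {z : α} {L L' : List α} (hL : L.head? ≠ some z)
    (hL' : L'.head? ≠ some z) {m m' : ℕ}
    (h : List.replicate m z ++ L = List.replicate m' z ++ L') : m = m' ∧ L = L' := by
  induction m generalizing m' with
  | zero =>
    cases m' with
    | zero => simpa using h
    | succ m' => simp [List.replicate_succ] at h; simp [h] at hL
  | succ m ih =>
    cases m' with
    | zero => simp [List.replicate_succ] at h; simp [← h] at hL'
    | succ m' =>
      simp only [List.replicate_succ, List.cons_append, List.cons.injEq, true_and] at h
      simpa using ih h

theorem head?_replicate_append {α : Type*} {z : α} {m : ℕ} (hm : 1 ≤ m) (L : List α) :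
    (List.replicate m z ++ L).head? = some z := by
  obtain ⟨k, rfl⟩ := Nat.exists_eq_add_of_le' hm
  simp [List.replicate_succ]

theorem blockWord_cons (e : ℕ × ℕ) (l : List (ℕ × ℕ)) :
    blockWord (e :: l) = List.replicate e.1 0 ++ (List.replicate e.2 1 ++ blockWord l) := by
  simp [blockWord]

theorem head?_blockWord_ne_one {l : List (ℕ × ℕ)} (hl : ∀ e ∈ l, 1 ≤ e.1 ∧ 1 ≤ e.2) :
    (blockWord l).head? ≠ some 1 := by
  cases l with
  | nil => simp [blockWord]
  | cons e l =>
    rw [blockWord_cons, head?_replicate_append (hl e (by simp)).1]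
    simp

theorem blockWord_inj {l l' : List (ℕ × ℕ)} (hl : ∀ e ∈ l, 1 ≤ e.1 ∧ 1 ≤ e.2)
    (hl' : ∀ e ∈ l', 1 ≤ e.1 ∧ 1 ≤ e.2) (h : blockWord l = blockWord l') : l = l' := by
  induction l generalizing l' with
  | nil =>
    cases l' with
    | nil => rfl
    | cons e l' =>
      have h1 := head?_replicate_append (z := (0 : Fin 2)) (hl' e (by simp)).1
        (List.replicate e.2 1 ++ blockWord l')
      rw [← blockWord_cons, ← h] at h1
      simp [blockWord] at h1
  | cons e l ih =>
    cases l' with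
    | nil =>
      have h1 := head?_replicate_append (z := (0 : Fin 2)) (hl e (by simp)).1
        (List.replicate e.2 1 ++ blockWord l)
      rw [← blockWord_cons, h] at h1
      simp [blockWord] at h1
    | cons e' l' =>
      simp only [List.mem_cons, forall_eq_or_imp] at hl hl'
      rw [blockWord_cons, blockWord_cons] at h
      obtain ⟨h1, h⟩ := replicate_append_inj
        (by rw [head?_replicate_append hl.1.2]; simp)
        (by rw [head?_replicate_append hl'.1.2]; simp) h
      obtain ⟨h2, h⟩ := replicate_append_inj (head?_blockWord_ne_one hl.2)
        (head?_blockWord_ne_one hl'.2) h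
      rw [ih hl.2 hl'.2 h, Prod.ext h1 h2]

theorem FreeGroup.prod_map_of_injective (α : Type*) :
    Function.Injective fun l : List α => (l.map FreeGroup.of).prod := by
  classical
  intro l l' h
  have hmk (l : List α) : (l.map FreeGroup.of).prod = FreeGroup.mk (l.map fun z => (z, true)) := by
    induction l with
    | nil => rfl
    | cons z l ih => rw [List.map_cons, List.prod_cons, ih]; rfl
  have hred (l : List α) : FreeGroup.IsReduced (l.map fun z => (z, true)) := by
    exact (List.pairwise_map.2 (List.pairwise_of_forall fun _ _ _ => rfl)).isChain
  have h2 := congrArg FreeGroup.toWord h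
  simp only [hmk, FreeGroup.toWord_mk, (hred _).reduce_eq] at h2
  exact List.map_injective_iff.2 (fun u v huv => congrArg Prod.fst huv) h2

theorem prod_map_of_blockWord (l : List (ℕ × ℕ)) :
    ((blockWord l).map FreeGroup.of).prod =
      (l.map fun e => (FreeGroup.of 0 : F2) ^ e.1 * FreeGroup.of 1 ^ e.2).prod := by
  induction l with
  | nil => rfl
  | cons e l ih => simp [blockWord_cons, ih, mul_assoc]

theorem prod_range_eq_iff {n t : ℕ} {x y x' y' : ℕ → ℕ}
    (h : ∀ i < n, 1 ≤ x i ∧ 1 ≤ y i) (h' : ∀ i < t, 1 ≤ x' i ∧ 1 ≤ y' i) :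
    ((List.range n).map fun i => (FreeGroup.of 0 : F2) ^ x i * FreeGroup.of 1 ^ y i).prod =
      ((List.range t).map fun i => (FreeGroup.of 0 : F2) ^ x' i * FreeGroup.of 1 ^ y' i).prod ↔
    n = t ∧ ∀ i < n, x i = x' i ∧ y i = y' i := by
  constructor
  · intro heq
    have hl : (List.range n).map (fun i => (x i, y i)) =
        (List.range t).map (fun i => (x' i, y' i)) := by
      apply blockWord_inj
      · simpa using h
      · simpa using h'
      · apply FreeGroup.prod_map_of_injective
        simpa [prod_map_of_blockWord, Function.comp_def] using heq
    obtain rfl : n = t := by simpa using congrArg List.length hl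
    exact ⟨rfl, by simpa using hl⟩
  · rintro ⟨rfl, h⟩
    congr 1
    refine List.map_congr_left fun i hi => ?_
    rw [(h i (List.mem_range.1 hi)).1, (h i (List.mem_range.1 hi)).2]

theorem prod_range_inv_left {H : Type*} [Group H] (u v : H) (p q : ℕ → ℕ) (s : ℕ) :
    v⁻¹ ^ p 1 * u⁻¹ ^ q 1 *
        ((List.range s).map fun j => v⁻¹ ^ p (j + 2) * u⁻¹ ^ q (j + 2)).prod =
      ((List.range (s + 1)).map fun i => u ^ q (s + 1 - i) * v ^ p (s + 1 - i)).prod⁻¹ := by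
  induction s with
  | zero => simp
  | succ s ih =>
    rw [List.range_succ, List.map_append, List.prod_append, ← mul_assoc, ih,
      List.range_succ_eq_map (n := s + 1)]
    simp [Function.comp_def]

theorem prod_range_inv_right {H : Type*} [Group H] (u v : H) (p q : ℕ → ℕ) (s : ℕ) :
    v⁻¹ ^ q 1 * ((List.range s).map fun j => u⁻¹ ^ p (j + 2) * v⁻¹ ^ q (j + 2)).prod *
        u⁻¹ ^ p (s + 2) =
      ((List.range (s + 1)).map fun i => u ^ p (s + 2 - i) * v ^ q (s + 1 - i)).prod⁻¹ := by
  induction s with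
  | zero => simp
  | succ s ih =>
    rw [List.range_succ, List.map_append, List.prod_append, ← mul_assoc,
      List.range_succ_eq_map (n := s + 1)]
    simp only [List.map_cons, List.map_nil, List.prod_cons, List.prod_nil, mul_one, ← mul_assoc, ih]
    simp [Function.comp_def, mul_assoc]

theorem fst_list_prod {M N : Type*} [Monoid M] [Monoid N] (l : List (M × N)) :
    l.prod.1 = (l.map Prod.fst).prod :=
  map_list_prod (MonoidHom.fst M N) l

theorem snd_list_prod {M N : Type*} [Monoid M] [Monoid N] (l : List (M × N)) :
    l.prod.2 = (l.map Prod.snd).prod :=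
  map_list_prod (MonoidHom.snd M N) l

/-- For `n, t ≥ 1` and positive exponents, the word
`(ca)^{x₁}(db)^{y₁}⋯(ca)^{x_n}(db)^{y_n} (b⁻¹)^{p₁}
 (d⁻¹a⁻¹)^{q₁}(c⁻¹b⁻¹)^{p₂}⋯(c⁻¹b⁻¹)^{p_t}(d⁻¹a⁻¹)^{q_t} (c⁻¹)^{p_{t+1}}`
maps to `1` in `F₂ × F₂` if and only if `n = t` and all the exponents are
equal to a single `m ≥ 1`. -/
theorem bigWord_eq_one_iff (n t : ℕ) (hn : 1 ≤ n) (ht : 1 ≤ t)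
    (x y q p : ℕ → ℕ)
    (hx : ∀ i, 1 ≤ i → i ≤ n → 1 ≤ x i) (hy : ∀ i, 1 ≤ i → i ≤ n → 1 ≤ y i)
    (hq : ∀ j, 1 ≤ j → j ≤ t → 1 ≤ q j)
    (hp : ∀ j, 1 ≤ j → j ≤ t + 1 → 1 ≤ p j) :
    π (bigWord n t x y q p) = 1 ↔
      (n = t ∧ ∃ m : ℕ, 1 ≤ m ∧
        (∀ i, 1 ≤ i → i ≤ n → x i = m ∧ y i = m) ∧
        (∀ j, 1 ≤ j → j ≤ t → q j = m) ∧
        (∀ j, 1 ≤ j → j ≤ t + 1 → p j = m)) := by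
  obtain ⟨s, rfl⟩ := Nat.exists_eq_add_of_le' ht
  have hfst : (π (bigWord n (s + 1) x y q p)).1 =
      ((List.range n).map fun i =>
        (FreeGroup.of 0 : F2) ^ x (i + 1) * FreeGroup.of 1 ^ y (i + 1)).prod *
      ((List.range (s + 1)).map fun i =>
        (FreeGroup.of 0 : F2) ^ q (s + 1 - i) * FreeGroup.of 1 ^ p (s + 1 - i)).prod⁻¹ := by
    rw [← prod_range_inv_left]
    simp [bigWord, π, letterVal, map_list_prod, fst_list_prod, Function.comp_def,
      mul_assoc]
  have hsnd : (π (bigWord n (s + 1) x y q p)).2 =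
      ((List.range n).map fun i =>
        (FreeGroup.of 0 : F2) ^ x (i + 1) * FreeGroup.of 1 ^ y (i + 1)).prod *
      ((List.range (s + 1)).map fun i =>
        (FreeGroup.of 0 : F2) ^ p (s + 2 - i) * FreeGroup.of 1 ^ q (s + 1 - i)).prod⁻¹ := by
    rw [← prod_range_inv_right]
    simp [bigWord, π, letterVal, map_list_prod, snd_list_prod, Function.comp_def,
      mul_assoc]
  have hxy : ∀ i < n, 1 ≤ x (i + 1) ∧ 1 ≤ y (i + 1) := fun i hi =>
    ⟨hx _ (by lia) (by lia), hy _ (by lia) (by lia)⟩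
  rw [Prod.ext_iff, hfst, hsnd, Prod.fst_one, Prod.snd_one, mul_inv_eq_one, mul_inv_eq_one,
    prod_range_eq_iff hxy fun i hi => ⟨hq _ (by lia) (by lia), hp _ (by lia) (by lia)⟩,
    prod_range_eq_iff hxy fun i hi => ⟨hp _ (by lia) (by lia), hq _ (by lia) (by lia)⟩]
  constructor
  · rintro ⟨⟨rfl, h1⟩, -, h2⟩
    have hxy' : ∀ i < s + 1, x (i + 1) = y (i + 1) := fun i hi =>
      (h1 i hi).1.trans (h2 i hi).2.symm
    have hxm : ∀ i < s + 1, x (i + 1) = x 1 := by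
      intro i
      induction i with
      | zero => simp
      | succ i ih =>
        intro hi
        rw [← ih (by lia), hxy' i (by lia), (h1 i (by lia)).2, (h2 (i + 1) hi).1]
        congr 1
        lia
    refine ⟨rfl, x 1, hx 1 le_rfl hn, fun i hi hin => ?_, fun j hj hjs => ?_, fun j hj hjs => ?_⟩
    · obtain ⟨k, rfl⟩ := Nat.exists_eq_add_of_le' hi
      exact ⟨hxm k (by lia), (hxy' k (by lia)).symm.trans (hxm k (by lia))⟩
    · rw [← hxm (s + 1 - j) (by lia), (h1 (s + 1 - j) (by lia)).1]
      congr 1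
      lia
    · obtain rfl | hj := hj.eq_or_lt
      · rw [← hxm s (by lia), hxy' s (by lia), (h1 s (by lia)).2]
        congr 1
        lia
      · rw [← hxm (s + 2 - j) (by lia), (h2 (s + 2 - j) (by lia)).1]
        congr 1
        lia
  · rintro ⟨rfl, m, -, h1, h2, h3⟩
    refine ⟨⟨rfl, fun i hi => ?_⟩, rfl, fun i hi => ?_⟩ <;>
      rw [(h1 (i + 1) (by lia) (by lia)).1, (h1 (i + 1) (by lia) (by lia)).2,
        h2 _ (by lia) (by lia), h3 _ (by lia) (by lia)] <;> exact ⟨rfl, rfl⟩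
end

section
/- Let a₁, …, a₅ be 5 pairwise distinct letters of an alphabet Σ, let L₅ = {a₁^{n₁} a₂^{n₂} a₃^{n₃} a₄^{n₄} a₅^{n₅} : n₁ ≥ n₂ ≥ n₃ ≥ n₄ ≥ n₅ ≥ 0}, let μ ∈ ℕ with μ ≥ 1, and let U = {(a₁^i, ε) : i ∈ ℕ, i ≥ μ} ⊆ (Σ*)². Then every w ∈ L₅ with |w| ≥ 5(μ−1)+1 can be written as w = a₁^μ w′ for some w′ ∈ Σ*, and the resulting factorisation w = ε · a₁^μ · ε · ε · w′ is U-switchable for L₅; that is, a₁^i w′ ∈ L₅ for every i ≥ μ. -/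
/-- The language `L₅ = {a₁^{n₁} a₂^{n₂} a₃^{n₃} a₄^{n₄} a₅^{n₅} :
n₁ ≥ n₂ ≥ n₃ ≥ n₄ ≥ n₅ ≥ 0}` over the letters `a 0, …, a 4`. -/
def descLang {σ : Type*} (a : Fin 5 → σ) : Set (List σ) :=
  {w | ∃ n : Fin 5 → ℕ, (∀ i j : Fin 5, i ≤ j → n j ≤ n i) ∧
    w = (List.ofFn fun i : Fin 5 => List.replicate (n i) (a i)).flatten}

/-- The up-set `U = {(a₁^i, ε) : i ≥ μ}`. -/
def upSet {σ : Type*} (a : Fin 5 → σ) (μ : ℕ) : Set (List σ × List σ) :=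
  {uv | ∃ i : ℕ, μ ≤ i ∧ uv = (List.replicate i (a 0), [])}

/-- Every `w ∈ L₅` with `|w| ≥ 5(μ-1)+1` can be written `w = a₁^μ w'`, and the
factorisation `w = ε · a₁^μ · ε · ε · w'` is `U`-switchable for `L₅`, where
`U = {(a₁^i, ε) : i ≥ μ}`; in particular `a₁^i w' ∈ L₅` for all `i ≥ μ`. -/
theorem descLang_switchable {σ : Type*} (a : Fin 5 → σ)
    (ha : Function.Injective a) (μ : ℕ) (hμ : 1 ≤ μ)
    (w : List σ) (hw : w ∈ descLang a) (hlen : 5 * (μ - 1) + 1 ≤ w.length) :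
    ∃ w' : List σ,
      w = [] ++ List.replicate μ (a 0) ++ [] ++ [] ++ w' ∧
      ∀ uv ∈ upSet a μ, [] ++ uv.1 ++ [] ++ uv.2 ++ w' ∈ descLang a := by
  obtain ⟨n, hn, rfl⟩ := hw
  have hn_le : ∀ i, n i ≤ n 0 := fun i => hn 0 i (Fin.zero_le i)
  have hμn : μ ≤ n 0 := by
    have h₁ := hn_le 1
    have h₂ := hn_le 2
    have h₃ := hn_le 3
    have h₄ := hn_le 4
    rw [List.length_flatten, List.map_ofFn, List.sum_ofFn, Fin.sum_univ_five] at hlen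
    simp only [Function.comp_apply, List.length_replicate] at hlen
    omega
  refine ⟨List.replicate (n 0 - μ) (a 0) ++
    (List.ofFn fun i : Fin 4 => List.replicate (n i.succ) (a i.succ)).flatten, ?_, ?_⟩
  · rw [List.ofFn_succ, List.flatten_cons]
    simp only [List.nil_append, List.append_nil]
    rw [← List.append_assoc, ← List.replicate_add, Nat.add_sub_cancel' hμn]
  · rintro _ ⟨i, hi, rfl⟩
    refine ⟨Fin.cons (i + (n 0 - μ)) fun j => n j.succ, ?_, ?_⟩
    · intro j k hjk
      cases j using Fin.cases with
      | zero =>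
        cases k using Fin.cases with
        | zero => exact le_rfl
        | succ k =>
          have := hn_le k.succ
          simp only [Fin.cons_zero, Fin.cons_succ]
          omega
      | succ j =>
        cases k using Fin.cases with
        | zero => exact absurd hjk (not_le.mpr (Fin.succ_pos j))
        | succ k => exact hn _ _ hjk
    · conv_rhs => rw [List.ofFn_succ, List.flatten_cons]
      simp only [List.nil_append, List.append_nil, Fin.cons_zero, Fin.cons_succ]
      rw [← List.append_assoc, ← List.replicate_add]
end
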